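/- Let H be a Hopf algebra over a field k and let c be a central element of H. Suppose that: (i) for every finite-dimensional simple left H-module V, c acts as zero on V if and only if V is isomorphic to the trivial module; and (ii) every finite-dimensional left H-module E containing a submodule W such that both W and E/W are isomorphic to the trivial module decomposes as an internal direct sum of W and another submodule. Then every finite-dimensional left H-module is semisimple. -/

import Mathlib

universe u

/-- `V` is isomorphic to the trivial `H`-module, i.e. to `k` with action `h • x = ε(h) x`. -/
def IsTrivialRep (k H : Type*) (V : Type*) [Field k] [Ring H] [HopfAlgebra k H]
    [AddCommGroup V] [Module k V] [Module H V] : Prop :=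
  ∃ e : V ≃ₗ[k] k, ∀ (h : H) (v : V), e (h • v) = Coalgebra.counit (R := k) h * e v

open TensorProduct Coalgebra in
noncomputable def adAct {k H A : Type*} [Field k] [Ring H] [HopfAlgebra k H] [Ring A] [Algebra k A]
    (ρ : H →ₐ[k] A) : H →ₐ[k] Module.End k A :=
  (AlgHom.mulLeftRight k A).comp
    ((Algebra.TensorProduct.map ρ ((AlgHom.op ρ).comp (HopfAlgebra.antipodeAlgHomOp k H))).comp
      (Bialgebra.comulAlgHom k H))

open TensorProduct Coalgebra in
lemma adAct_apply {k H A : Type*} [Field k] [Ring H] [HopfAlgebra k H] [Ring A] [Algebra k A]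
    (ρ : H →ₐ[k] A) (h : H) {ι : Type*} (r : Coalgebra.Repr k h ι) (f : A) :
    adAct ρ h f = ∑ i ∈ r.index, ρ (r.left i) * f * ρ (HopfAlgebra.antipode k (r.right i)) := by
  simp [adAct, ← r.eq, map_sum]

open TensorProduct Coalgebra in
lemma commute_of_inv {k H A : Type*} [Field k] [Ring H] [HopfAlgebra k H] [Ring A] [Algebra k A]
    (ρ : H →ₐ[k] A) (f : A) (hf : ∀ h : H, adAct ρ h f = counit (R := k) h • f) (h : H) :
    ρ h * f = f * ρ h := by
  have e := sum_tmul_tmul_eq (R := k) (ℛ k h) (fun i => ℛ k ((ℛ k h).left i))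
    (fun i => ℛ k ((ℛ k h).right i))
  apply_fun (LinearMap.mul' k A ∘ₗ TensorProduct.map ((LinearMap.mulRight k f) ∘ₗ ρ.toLinearMap)
    (LinearMap.mul' k A ∘ₗ TensorProduct.map (ρ.toLinearMap ∘ₗ HopfAlgebra.antipode k)
      ρ.toLinearMap)) at e
  simp only [map_sum, LinearMap.comp_apply, TensorProduct.map_tmul, LinearMap.mul'_apply,
    LinearMap.mulRight_apply, AlgHom.toLinearMap_apply] at e
  have h1 : ∀ i, ∑ j ∈ (ℛ k ((ℛ k h).left i)).index,
      ρ ((ℛ k ((ℛ k h).left i)).left j) * f *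
        (ρ (HopfAlgebra.antipode k ((ℛ k ((ℛ k h).left i)).right j)) * ρ ((ℛ k h).right i)) =
      f * ρ (counit (R := k) ((ℛ k h).left i) • (ℛ k h).right i) := by
    intro i
    simp only [← mul_assoc]
    rw [← Finset.sum_mul, ← adAct_apply, hf]
    simp
  have h2 : ∀ i, ∑ j ∈ (ℛ k ((ℛ k h).right i)).index,
      ρ ((ℛ k h).left i) * f *
        (ρ (HopfAlgebra.antipode k ((ℛ k ((ℛ k h).right i)).left j)) *
          ρ ((ℛ k ((ℛ k h).right i)).right j)) =
      ρ (counit (R := k) ((ℛ k h).right i) • (ℛ k h).left i) * f := by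
    intro i
    simp only [← map_mul]
    rw [← Finset.mul_sum, ← map_sum, HopfAlgebra.sum_antipode_mul_eq_smul]
    simp
  rw [Finset.sum_congr rfl (fun i _ => h1 i), Finset.sum_congr rfl (fun i _ => h2 i),
    ← Finset.mul_sum, ← map_sum, ← Finset.sum_mul, ← map_sum, sum_counit_smul] at e
  rw [e]
  congr 2
  have := sum_tmul_counit_eq (R := k) (ℛ k h)
  apply_fun TensorProduct.rid k H at this
  simp only [map_sum, TensorProduct.rid_tmul, one_smul] at this
  exact this.symm

lemma IsTrivialRep.counit_smul {k H V : Type*} [Field k] [Ring H] [HopfAlgebra k H]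
    [AddCommGroup V] [Module k V] [Module H V] (hV : IsTrivialRep k H V) (h : H) (v : V) :
    h • v = Coalgebra.counit (R := k) h • v := by
  obtain ⟨e, he⟩ := hV
  apply e.injective
  rw [he, map_smul, smul_eq_mul]

lemma IsTrivialRep.congr {k H V V' : Type*} [Field k] [Ring H] [HopfAlgebra k H]
    [AddCommGroup V] [Module k V] [Module H V] [IsScalarTower k H V]
    [AddCommGroup V'] [Module k V'] [Module H V'] [IsScalarTower k H V']
    (hV : IsTrivialRep k H V) (f : V ≃ₗ[H] V') : IsTrivialRep k H V' := by
  obtain ⟨e, he⟩ := hV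
  refine ⟨(f.restrictScalars k).symm.trans e, fun h v => ?_⟩
  have : f.symm (h • v) = h • f.symm v := map_smul _ _ _
  simp [this, he]

lemma IsTrivialRep.simple {k H V : Type*} [Field k] [Ring H] [HopfAlgebra k H]
    [AddCommGroup V] [Module k V] [Module H V] [IsScalarTower k H V]
    (hV : IsTrivialRep k H V) : IsSimpleModule H V := by
  obtain ⟨e, he⟩ := hV
  have : Nontrivial V := e.toEquiv.nontrivial
  refine isSimpleModule_iff_toSpanSingleton_surjective.2 ⟨inferInstance, fun v hv w => ?_⟩
  refine ⟨algebraMap k H (e w / e v), ?_⟩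
  have : e v ≠ 0 := by simpa using hv
  simp only [LinearMap.toSpanSingleton_apply, algebraMap_smul]
  apply e.injective
  simp [this]

lemma fd_submodule (k H : Type*) {E : Type*} [Field k] [Ring H] [Algebra k H]
    [AddCommGroup E] [Module k E] [Module H E] [IsScalarTower k H E] [FiniteDimensional k E]
    (S : Submodule H E) : FiniteDimensional k S :=
  inferInstanceAs (FiniteDimensional k (S.restrictScalars k))

lemma casimir_codim_one (k H : Type u) [Field k] [Ring H] [HopfAlgebra k H]
    (c : H) (hc : ∀ h : H, c * h = h * c)
    (hCasimir : ∀ (V : Type u) [AddCommGroup V] [Module k V] [Module H V]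
      [IsScalarTower k H V] [FiniteDimensional k V] [IsSimpleModule H V],
      (∀ v : V, c • v = 0) ↔ IsTrivialRep k H V)
    (hExt : ∀ (E : Type u) [AddCommGroup E] [Module k E] [Module H E]
      [IsScalarTower k H E] [FiniteDimensional k E] (W : Submodule H E),
      IsTrivialRep k H W → IsTrivialRep k H (E ⧸ W) →
      ∃ W' : Submodule H E, W ⊓ W' = ⊥ ∧ W ⊔ W' = ⊤) (n : ℕ) :
    ∀ (E : Type u) [AddCommGroup E] [Module k E] [Module H E]
      [IsScalarTower k H E] [FiniteDimensional k E] (W : Submodule H E),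
      Module.finrank k W = n → IsTrivialRep k H (E ⧸ W) →
      ∃ W' : Submodule H E, IsCompl W W' := by
  induction n using Nat.strong_induction_on with
  | _ n ih =>
  intro E _ _ _ _ _ W hn hW
  have fd : ∀ S : Submodule H E, FiniteDimensional k S := fd_submodule k H
  by_cases hb : W = ⊥
  · exact ⟨⊤, hb ▸ isCompl_bot_top⟩
  by_cases hS : ∃ S : Submodule H E, S ≠ ⊥ ∧ S < W
  · obtain ⟨S, hS0, hSW⟩ := hS
    have hpos : 0 < Module.finrank k S := by
      have := Submodule.nontrivial_iff_ne_bot.2 hS0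
      exact Module.finrank_pos
    have hlt : Module.finrank k S < Module.finrank k W :=
      Submodule.finrank_lt_finrank_of_lt (s := S.restrictScalars k) (t := W.restrictScalars k) hSW
    -- quotient
    have hq : Module.finrank k (W.map S.mkQ) < n := by
      have hle : S.comap W.subtype ≠ ⊥ := by
        obtain ⟨s, hs, hs0⟩ := S.ne_bot_iff.1 hS0
        refine (Submodule.ne_bot_iff _).2 ⟨⟨s, hSW.le hs⟩, hs, fun h => hs0 ?_⟩
        exact congrArg Subtype.val h
      have h1 := LinearMap.finrank_range_add_finrank_ker
          ((S.mkQ ∘ₗ W.subtype).restrictScalars k)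
      have h2 : Module.finrank k (LinearMap.range ((S.mkQ ∘ₗ W.subtype).restrictScalars k)) =
          Module.finrank k (W.map S.mkQ) := by
        have : W.map S.mkQ = LinearMap.range (S.mkQ ∘ₗ W.subtype) := by
          rw [LinearMap.range_comp, Submodule.range_subtype]
        rw [this]
        rfl
      have : 0 < Module.finrank k
          (LinearMap.ker ((S.mkQ ∘ₗ W.subtype).restrictScalars k)) := by
        obtain ⟨s, hs, hs0⟩ := (Submodule.ne_bot_iff _).1 hle
        rw [Module.finrank_pos_iff_exists_ne_zero]
        refine ⟨⟨s, by simpa using hs⟩, fun h => hs0 ?_⟩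
        exact congrArg Subtype.val h
      omega
    have hq2 : IsTrivialRep k H ((E ⧸ S) ⧸ W.map S.mkQ) :=
      hW.congr (Submodule.quotientQuotientEquivQuotient S W hSW.le).symm
    obtain ⟨U', hU'⟩ := ih _ hq (E ⧸ S) (W.map S.mkQ) rfl hq2
    set U := U'.comap S.mkQ with hU
    have hSU : S ≤ U := by
      intro s hs
      have : S.mkQ s = 0 := by simpa using hs
      show S.mkQ s ∈ U'
      rw [this]; exact U'.zero_mem
    have hWU : W ⊓ U = S := by
      apply le_antisymm
      · rintro x ⟨hx, hxU⟩
        have : S.mkQ x ∈ W.map S.mkQ ⊓ U' := ⟨⟨x, hx, rfl⟩, hxU⟩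
        rw [hU'.inf_eq_bot] at this
        simpa using this
      · exact le_inf hSW.le hSU
    have hWU2 : W ⊔ U = ⊤ := by
      rw [eq_top_iff]
      intro x _
      have : S.mkQ x ∈ W.map S.mkQ ⊔ U' := by rw [hU'.sup_eq_top]; trivial
      obtain ⟨_, ⟨w, hw, rfl⟩, u, hu, hwu⟩ := Submodule.mem_sup.1 this
      refine Submodule.mem_sup.2 ⟨w, hw, x - w, ?_, by abel⟩
      show S.mkQ (x - w) ∈ U'
      rw [map_sub, ← hwu]
      simpa using hu
    -- U / S ≅ E / W
    have e1 : (U ⧸ S.comap U.subtype) ≃ₗ[H] (E ⧸ W) := by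
      refine (Submodule.quotEquivOfEq _ _ ?_).trans
        ((LinearMap.quotKerEquivOfSurjective (W.mkQ ∘ₗ U.subtype) ?_))
      · rw [LinearMap.ker_comp, Submodule.ker_mkQ, ← hWU]
        ext x; simp
      · intro y
        obtain ⟨x, rfl⟩ := W.mkQ_surjective y
        have : x ∈ W ⊔ U := by rw [hWU2]; trivial
        obtain ⟨w, hw, u, hu, rfl⟩ := Submodule.mem_sup.1 this
        exact ⟨⟨u, hu⟩, by simp [hw]⟩
    have hfr : Module.finrank k (S.comap U.subtype) = Module.finrank k S :=
      ((Submodule.comapSubtypeEquivOfLe hSU).restrictScalars k).finrank_eq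
    obtain ⟨T, hT⟩ := ih _ (hlt.trans_eq hn) U (S.comap U.subtype) hfr (hW.congr e1.symm)
    refine ⟨T.map U.subtype, IsCompl.of_eq ?_ ?_⟩
    · rw [eq_bot_iff]
      rintro _ ⟨hx, ⟨t, ht, rfl⟩⟩
      have : t ∈ S.comap U.subtype ⊓ T := by
        refine ⟨?_, ht⟩
        rw [← hWU]
        exact ⟨hx, t.2⟩
      rw [hT.inf_eq_bot] at this
      simpa using this
    · rw [eq_top_iff, ← hWU2]
      refine sup_le le_sup_left fun u hu => ?_
      have : (⟨u, hu⟩ : U) ∈ S.comap U.subtype ⊔ T := by rw [hT.sup_eq_top]; trivial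
      obtain ⟨s, hs, t, ht, hst⟩ := Submodule.mem_sup.1 this
      exact Submodule.mem_sup.2 ⟨s, hSW.le hs, t, ⟨t, ht, rfl⟩, congrArg Subtype.val hst⟩
  · push Not at hS
    have hat : IsAtom W := ⟨hb, fun S hS' => by
      by_contra h
      exact hS S h hS'⟩
    have : IsSimpleModule H W := isSimpleModule_iff_isAtom.2 hat
    by_cases htr : IsTrivialRep k H W
    · obtain ⟨W', h1, h2⟩ := hExt E W htr hW
      exact ⟨W', IsCompl.of_eq h1 h2⟩
    · have hnz : ¬ ∀ v : W, c • v = 0 := fun h => htr ((hCasimir W).1 h)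
      let C : E →ₗ[H] E :=
        { toFun := fun x => c • x
          map_add' := smul_add c
          map_smul' := fun h x => by simp [← mul_smul, hc] }
      have hCW : ∀ x, C x ∈ W := by
        intro x
        have := hW.simple
        have := (hCasimir (E ⧸ W)).2 hW (W.mkQ x)
        rw [← map_smul, Submodule.mkQ_apply, Submodule.Quotient.mk_eq_zero] at this
        exact this
      have hker : W ⊓ LinearMap.ker C = ⊥ := by
        rcases hat.le_iff.1 (inf_le_left : W ⊓ LinearMap.ker C ≤ W) with h | h
        · exact h
        · exfalso; apply hnz
          intro v
          have : (v : E) ∈ W ⊓ LinearMap.ker C := by rw [h]; exact v.2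
          exact Subtype.ext this.2
      have hmap : W.map C = W := by
        rcases hat.le_iff.1 (show W.map C ≤ W by rintro _ ⟨x, _, rfl⟩; exact hCW x) with h | h
        · exfalso; apply hnz
          intro v
          have : C v ∈ W.map C := ⟨v, v.2, rfl⟩
          rw [h] at this
          exact Subtype.ext this
        · exact h
      refine ⟨LinearMap.ker C, IsCompl.of_eq hker ?_⟩
      rw [eq_top_iff]
      intro x _
      have : C x ∈ W.map C := hmap.symm ▸ hCW x
      obtain ⟨w, hw, hwx⟩ := this
      exact Submodule.mem_sup.2 ⟨w, hw, x - w, by simp [hwx], by abel⟩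

lemma exists_invariant (k H : Type u) [Field k] [Ring H] [HopfAlgebra k H]
    (hA : ∀ (E : Type u) [AddCommGroup E] [Module k E] [Module H E]
      [IsScalarTower k H E] [FiniteDimensional k E] (W : Submodule H E),
      IsTrivialRep k H (E ⧸ W) → ∃ W' : Submodule H E, IsCompl W W')
    (M : Type u) [AddCommGroup M] [Module k M] [FiniteDimensional k M]
    (ρ : H →ₐ[k] Module.End k M) (N : Submodule k M) (hN : ∀ h, ∀ m ∈ N, ρ h m ∈ N)
    (l : M →ₗ[k] k) (hl : ∀ h m, l (ρ h m) = Coalgebra.counit (R := k) h * l m)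
    (h0 : ∃ m ∈ N, l m = 1) :
    ∃ m ∈ N, l m = 1 ∧ ∀ h, ρ h m = Coalgebra.counit (R := k) h • m := by
  letI : Module H M := Module.compHom M ρ.toRingHom
  have hs : ∀ (h : H) (m : M), h • m = ρ h m := fun _ _ => rfl
  haveI : IsScalarTower k H M := ⟨fun a h m => by simp [hs]⟩
  let N' : Submodule H M := { N with smul_mem' := fun h m hm => hN h m hm }
  haveI : FiniteDimensional k N' := fd_submodule k H N'
  let K : Submodule H N' :=
    { carrier := {x | l x = 0}
      add_mem' := fun {a b} ha hb => by
        simp only [Set.mem_ofPred_eq] at *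
        simp [ha, hb]
      zero_mem' := by simp
      smul_mem' := fun h x hx => by
        simp only [Set.mem_ofPred_eq] at *
        simp [hs, hl, hx] }
  have hK : ∀ x : N', x ∈ K ↔ l x = 0 := fun _ => Iff.rfl
  have htriv : IsTrivialRep k H (N' ⧸ K) := by
    let l' : N' →ₗ[k] k := l ∘ₗ N'.subtype.restrictScalars k
    have hl' : Function.Surjective l' := by
      obtain ⟨m, hm, h1⟩ := h0
      intro a
      refine ⟨a • (⟨m, hm⟩ : N'), ?_⟩
      rw [map_smul]
      have : l' ⟨m, hm⟩ = 1 := h1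
      simp [this]
    let e0 : (N' ⧸ K) ≃ₗ[k] (N' ⧸ LinearMap.ker l') :=
      (Submodule.Quotient.restrictScalarsEquiv k K).symm.trans
        (Submodule.quotEquivOfEq _ _ (by ext x; rfl))
    refine ⟨e0.trans (LinearMap.quotKerEquivOfSurjective l' hl'), ?_⟩
    intro h v
    obtain ⟨x, rfl⟩ := K.mkQ_surjective v
    rw [← map_smul]
    exact hl h x
  obtain ⟨T, hT⟩ := hA N' K htriv
  obtain ⟨m, hm, h1⟩ := h0
  have : (⟨m, hm⟩ : N') ∈ K ⊔ T := by rw [hT.sup_eq_top]; trivial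
  obtain ⟨x, hx, t, ht, hxt⟩ := Submodule.mem_sup.1 this
  have hlt : l t = 1 := by
    have h2 : (x : M) + t = m := congrArg Subtype.val hxt
    rw [← h1, ← h2, map_add, (hK x).1 hx, zero_add]
  refine ⟨t, t.2, hlt, fun h => ?_⟩
  have h3 : h • t - Coalgebra.counit (R := k) h • t ∈ K ⊓ T := by
    refine ⟨?_, T.sub_mem (T.smul_mem h ht) (T.smul_of_tower_mem _ ht)⟩
    show l (ρ h t - Coalgebra.counit (R := k) h • (t : M)) = 0
    simp [hl]
  rw [hT.inf_eq_bot, Submodule.mem_bot] at h3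
  exact sub_eq_zero.1 (congrArg Subtype.val h3)

/-- if a Hopf algebra `H` has a central (Casimir) element `c` such that
(i) `c` acts by zero on a finite-dimensional simple module iff that module is trivial, and
(ii) every self-extension of the trivial module splits, then every finite-dimensional left
`H`-module is semisimple. -/
theorem semisimple_of_casimir (k H : Type u) [Field k] [Ring H] [HopfAlgebra k H]
    (c : H) (hc : ∀ h : H, c * h = h * c)
    (hCasimir : ∀ (V : Type u) [AddCommGroup V] [Module k V] [Module H V]
      [IsScalarTower k H V] [FiniteDimensional k V] [IsSimpleModule H V],
      (∀ v : V, c • v = 0) ↔ IsTrivialRep k H V)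
    (hExt : ∀ (E : Type u) [AddCommGroup E] [Module k E] [Module H E]
      [IsScalarTower k H E] [FiniteDimensional k E] (W : Submodule H E),
      IsTrivialRep k H W → IsTrivialRep k H (E ⧸ W) →
      ∃ W' : Submodule H E, W ⊓ W' = ⊥ ∧ W ⊔ W' = ⊤) :
    ∀ (V : Type u) [AddCommGroup V] [Module k V] [Module H V] [IsScalarTower k H V]
      [FiniteDimensional k V], IsSemisimpleModule H V := by
  have hA : ∀ (E : Type u) [AddCommGroup E] [Module k E] [Module H E]
      [IsScalarTower k H E] [FiniteDimensional k E] (W : Submodule H E),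
      IsTrivialRep k H (E ⧸ W) → ∃ W' : Submodule H E, IsCompl W W' :=
    fun E _ _ _ _ _ W hW => casimir_codim_one k H c hc hCasimir hExt _ E W rfl hW
  intro V _ _ _ _ _
  refine (isSemisimpleModule_iff H V).2 ⟨fun W => ?_⟩
  let σ : H →ₐ[k] Module.End k V := Algebra.lsmul k k V
  have hσ : ∀ h v, σ h v = h • v := fun _ _ => rfl
  let ρ : H →ₐ[k] Module.End k (Module.End k V × k) := AlgHom.ofLinearMap
    { toFun := fun h => LinearMap.prodMap (adAct σ h)
        (LinearMap.lsmul k k (Coalgebra.counit (R := k) h))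
      map_add' := fun a b => by ext <;> simp
      map_smul' := fun a b => by ext <;> simp }
    (by ext <;> simp) (fun a b => by ext <;> simp)
  have hρ : ∀ h p, ρ h p = (adAct σ h p.1, Coalgebra.counit (R := k) h * p.2) := fun _ _ => rfl
  let N : Submodule k (Module.End k V × k) :=
    { carrier := {p | (∀ v, p.1 v ∈ W) ∧ ∀ w ∈ W, p.1 w = p.2 • w}
      add_mem' := fun {a b} ha hb => ⟨fun v => W.add_mem (ha.1 v) (hb.1 v), fun w hw => by
        simp [ha.2 w hw, hb.2 w hw, add_smul]⟩
      zero_mem' := ⟨fun v => by simp, fun w hw => by simp⟩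
      smul_mem' := fun a p hp => ⟨fun v => W.smul_of_tower_mem a (hp.1 v), fun w hw => by
        simp [hp.2 w hw, mul_smul]⟩ }
  have hN : ∀ h, ∀ m ∈ N, ρ h m ∈ N := by
    rintro h p ⟨hp1, hp2⟩
    rw [hρ, adAct_apply σ h (Coalgebra.Repr.arbitrary k h)]
    constructor
    · intro v
      simp only [LinearMap.sum_apply, Module.End.mul_apply, hσ]
      exact W.sum_mem fun i _ => W.smul_mem _ (hp1 _)
    · intro w hw
      simp only [LinearMap.sum_apply, Module.End.mul_apply, hσ]
      have : ∀ i : H × H, (i.1 • p.1 (HopfAlgebra.antipode k i.2 • w)) =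
          p.2 • ((i.1 * HopfAlgebra.antipode k i.2) • w) := by
        intro i
        rw [hp2 _ (W.smul_mem _ hw), smul_comm, mul_smul]
      have h2 := HopfAlgebra.sum_mul_antipode_eq_smul (Coalgebra.Repr.arbitrary k h)
      refine (Finset.sum_congr rfl fun i _ => this i).trans ?_
      rw [← Finset.smul_sum, ← Finset.sum_smul]
      refine (congrArg (fun x : H => p.2 • x • w) h2).trans ?_
      simp only [smul_assoc, one_smul, mul_smul]
      exact smul_comm _ _ _
  have h0 : ∃ m ∈ N, LinearMap.snd k (Module.End k V) k m = 1 := by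
    obtain ⟨q, hq⟩ := (W.restrictScalars k).exists_isCompl
    refine ⟨((W.restrictScalars k).subtype ∘ₗ
      Submodule.projectionOnto (W.restrictScalars k) q hq, 1), ⟨fun v => ?_, fun w hw => ?_⟩, rfl⟩
    · exact (Submodule.projectionOnto (W.restrictScalars k) q hq v).2
    · have := Submodule.projectionOnto_apply_left hq ⟨w, hw⟩
      exact (congrArg Subtype.val this).trans (one_smul k w).symm
  obtain ⟨p, hp, hp1, hpinv⟩ := exists_invariant k H hA (Module.End k V × k) ρ N hN
    (LinearMap.snd k _ _) (fun h m => rfl) h0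
  · have hcomm := commute_of_inv σ p.1 (fun h => congrArg Prod.fst (hpinv h))
    have hp1 : p.2 = 1 := hp1
    let P : V →ₗ[H] V :=
      { toFun := p.1
        map_add' := map_add p.1
        map_smul' := fun h v => (LinearMap.congr_fun (hcomm h) v).symm }
    refine ⟨LinearMap.ker P, IsCompl.of_eq ?_ ?_⟩
    · rw [eq_bot_iff]
      rintro x ⟨hx, hx0⟩
      have h1 : p.1 x = 0 := hx0
      rw [hp.2 x hx, hp1, one_smul] at h1
      simpa using h1
    · rw [eq_top_iff]
      intro x _
      refine Submodule.mem_sup.2 ⟨p.1 x, hp.1 x, x - p.1 x, ?_, by abel⟩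
      show p.1 (x - p.1 x) = 0
      rw [map_sub, hp.2 _ (hp.1 x), hp1, one_smul, sub_self]
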